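/- Let λ, ρ₀ > 0 and let ρ : (0,∞) → ℝ be a C² solution of (r²ρ')' = ρ + λr²(ρ² - ρ₀²)ρ satisfying 0 < ρ(r) ≤ b for all r ≥ r₁ > 0, where 0 < b < ρ₀, and ρ(r) ≥ b/2 for r ≥ r₁. Then ρ'(r) → -∞ as r → ∞. In particular, ρ cannot satisfy ρ' ≥ 0 on (0,∞) with ρ(r) → b < ρ₀. -/

import Mathlib

open Real Filter Set

theorem stmt6 (lam ρ₀ b r₁ : ℝ) (hlam : 0 < lam) (hρ₀ : 0 < ρ₀)
    (hb : 0 < b) (hbρ₀ : b < ρ₀) (hr₁ : 0 < r₁) (ρ : ℝ → ℝ)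
    (hρ : ContDiffOn ℝ 2 ρ (Ioi 0))
    (hODE : ∀ r > (0 : ℝ), deriv (fun r => r ^ 2 * deriv ρ r) r =
      ρ r + lam * r ^ 2 * ((ρ r) ^ 2 - ρ₀ ^ 2) * ρ r)
    (hbound : ∀ r ≥ r₁, 0 < ρ r ∧ ρ r ≤ b ∧ b / 2 ≤ ρ r) :
    Tendsto (deriv ρ) atTop atBot ∧ ¬ (∀ r > (0 : ℝ), 0 ≤ deriv ρ r) := by
  have key : Tendsto (deriv ρ) atTop atBot := by
    have hd1 : ContDiffOn ℝ 1 (deriv ρ) (Ioi 0) :=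
      hρ.deriv_of_isOpen isOpen_Ioi (by norm_num)
    have hd : ∀ r > (0 : ℝ), DifferentiableAt ℝ (deriv ρ) r := fun r hr =>
      (hd1.differentiableOn (by norm_num)).differentiableAt (isOpen_Ioi.mem_nhds hr)
    obtain ⟨c, hc⟩ : ∃ c, c = lam * (b / 2) * (ρ₀ ^ 2 - b ^ 2) := ⟨_, rfl⟩
    have hcpos : 0 < c := by
      have : 0 < ρ₀ ^ 2 - b ^ 2 := by nlinarith
      rw [hc]; positivity
    have hG : ∀ r > (0 : ℝ), HasDerivAt
        (fun r => r ^ 2 * deriv ρ r - (b * r - c * r ^ 3 / 3))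
        (ρ r + lam * r ^ 2 * ((ρ r) ^ 2 - ρ₀ ^ 2) * ρ r - (b - c * r ^ 2)) r := by
      intro r hr
      have h1 : HasDerivAt (fun r => r ^ 2 * deriv ρ r) _ r :=
        (DifferentiableAt.mul (differentiableAt_id.pow 2) (hd r hr)).hasDerivAt
      have h1' : HasDerivAt (fun r => r ^ 2 * deriv ρ r)
        (ρ r + lam * r ^ 2 * ((ρ r) ^ 2 - ρ₀ ^ 2) * ρ r) r := by
        rw [← hODE r hr]; exact h1
      have h2 : HasDerivAt (fun r : ℝ => b * r - c * r ^ 3 / 3) (b - c * r ^ 2) r := by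
        have h3 : HasDerivAt (fun r : ℝ => b * r - c * r ^ 3 / 3) _ r :=
          ((hasDerivAt_id' r).const_mul b).sub (((hasDerivAt_pow 3 r).const_mul c).div_const 3)
        refine h3.congr_deriv ?_
        norm_num
        ring
      exact h1'.sub h2
    have hanti : AntitoneOn (fun r => r ^ 2 * deriv ρ r - (b * r - c * r ^ 3 / 3)) (Ici r₁) := by
      apply antitoneOn_of_deriv_nonpos (convex_Ici r₁)
      · intro r hr
        exact (hG r (lt_of_lt_of_le hr₁ hr)).continuousAt.continuousWithinAt
      · intro r hr
        rw [interior_Ici] at hr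
        exact (hG r (hr₁.trans hr)).differentiableAt.differentiableWithinAt
      · intro r hr
        rw [interior_Ici] at hr
        rw [(hG r (hr₁.trans hr)).deriv]
        obtain ⟨h0, h1, h2⟩ := hbound r (le_of_lt hr)
        have h3 : (b / 2) * (ρ₀ ^ 2 - b ^ 2) ≤ ρ r * (ρ₀ ^ 2 - (ρ r) ^ 2) := by
          apply mul_le_mul h2 _ _ h0.le
          · nlinarith
          · nlinarith
        have h4 := mul_le_mul_of_nonneg_left h3 (show 0 ≤ lam * r ^ 2 by positivity)
        rw [hc]
        nlinarith
    obtain ⟨C, hC⟩ : ∃ C, C = r₁ ^ 2 * deriv ρ r₁ - (b * r₁ - c * r₁ ^ 3 / 3) := ⟨_, rfl⟩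
    have hle : ∀ r ≥ r₁, deriv ρ r ≤ (|C| / r₁ ^ 2 + b / r₁) + (-(c / 3)) * r := by
      intro r hr
      have hr0 : 0 < r := lt_of_lt_of_le hr₁ hr
      have h := hanti (mem_Ici.2 le_rfl) (mem_Ici.2 hr) hr
      simp only [← hC] at h
      have e1 : |C| ≤ |C| / r₁ ^ 2 * r ^ 2 := by
        rw [div_mul_eq_mul_div, le_div_iff₀ (by positivity)]
        gcongr
      have e2 : b * r ≤ b / r₁ * r ^ 2 := by
        rw [div_mul_eq_mul_div, le_div_iff₀ (by positivity)]
        nlinarith [mul_pos hb hr0]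
      have e3 := le_abs_self C
      have : r ^ 2 * deriv ρ r ≤ r ^ 2 * ((|C| / r₁ ^ 2 + b / r₁) + (-(c / 3)) * r) := by
        nlinarith
      exact le_of_mul_le_mul_left this (by positivity)
    refine tendsto_atBot_mono' atTop
      (f₁ := fun r => (|C| / r₁ ^ 2 + b / r₁) + (-(c / 3)) * r) ?_ ?_
    · filter_upwards [eventually_ge_atTop r₁] with r hr using hle r hr
    · exact tendsto_atBot_add_const_left _ _
        (tendsto_id.const_mul_atTop_of_neg (by linarith))
  refine ⟨key, fun h => ?_⟩
  obtain ⟨r, h1, h2⟩ := ((key.eventually_lt_atBot 0).and (eventually_gt_atTop 0)).exists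
  exact absurd (h r h2) (not_le.2 h1)
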